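/- Substitution lemma for internal parallel reduction: for φ-terms t, s, q, r and any n ∈ ℕ, if t ⇛ᵢ s and q ⇛ᵢ r then t[ρ^n ↦ q] ⇛ᵢ s[ρ^n ↦ r]. -/

import Mathlib

namespace PhiCalc

/-- φ-terms over a set of attribute labels `L`. An object term carries a finite
list of attributes: `(a, none)` is a void attribute, `(b, some t)` is an
attached attribute. -/
inductive Tm (L : Type) : Type where
  | loc : Nat → Tm L
  | dot : Tm L → L → Tm L
  | app : Tm L → L → Tm L → Tm L
  | obj : List (L × Option (Tm L)) → Tm L

namespace Tm

variable {L : Type}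

/-- Look up a label among the attributes of an object:
`none` = the label is missing, `some none` = void attribute,
`some (some t)` = attribute attached to `t`. -/
def lookupAttr [DecidableEq L] (a : L) : List (L × Option (Tm L)) → Option (Option (Tm L))
  | [] => none
  | (b, o) :: rest => if a = b then some o else lookupAttr a rest

/-- Attach term `u` to the (first occurrence of) label `a`. -/
def attachAttr [DecidableEq L] (a : L) (u : Tm L) :
    List (L × Option (Tm L)) → List (L × Option (Tm L))
  | [] => []
  | (b, o) :: rest => if a = b then (b, some u) :: rest else (b, o) :: attachAttr a u rest

mutual
/-- Locator increment `↑ₙ t`. -/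
def incAt : Nat → Tm L → Tm L
  | n, loc m => if m < n then loc m else loc (m + 1)
  | n, dot t a => dot (incAt n t) a
  | n, app t a u => app (incAt n t) a (incAt n u)
  | n, obj attrs => obj (incAtList (n + 1) attrs)

def incAtList : Nat → List (L × Option (Tm L)) → List (L × Option (Tm L))
  | _, [] => []
  | n, (a, none) :: rest => (a, none) :: incAtList n rest
  | n, (a, some t) :: rest => (a, some (incAt n t)) :: incAtList n rest
end

mutual
/-- Locator substitution `t[ρ^n ↦ u]`. -/
def subst : Tm L → Nat → Tm L → Tm L
  | loc m, n, u => if m < n then loc m else if m = n then u else loc (m - 1)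
  | dot t a, n, u => dot (subst t n u) a
  | app t a v, n, u => app (subst t n u) a (subst v n u)
  | obj attrs, n, u => obj (substList attrs (n + 1) (incAt 0 u))

def substList : List (L × Option (Tm L)) → Nat → Tm L → List (L × Option (Tm L))
  | [], _, _ => []
  | (a, none) :: rest, n, u => (a, none) :: substList rest n u
  | (a, some t) :: rest, n, u => (a, some (subst t n u)) :: substList rest n u
end

section Reductions

variable [DecidableEq L]

/-- One-step (regular) reduction `⇝`, parametrized by the decorator label `phi`. -/
inductive Step (phi : L) : Tm L → Tm L → Prop where
  | congObj {t t' : Tm L} (pre post : List (L × Option (Tm L))) (b : L) :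
      Step phi t t' →
      Step phi (obj (pre ++ (b, some t) :: post)) (obj (pre ++ (b, some t') :: post))
  | congDot {t t' : Tm L} (a : L) : Step phi t t' → Step phi (dot t a) (dot t' a)
  | congAppL {t t' u : Tm L} (a : L) : Step phi t t' → Step phi (app t a u) (app t' a u)
  | congAppR {t u u' : Tm L} (a : L) : Step phi u u' → Step phi (app t a u) (app t a u')
  | dotStep {attrs : List (L × Option (Tm L))} {c : L} {tc : Tm L} :
      lookupAttr c attrs = some (some tc) →
      Step phi (dot (obj attrs) c) (subst tc 0 (obj attrs))
  | dotPhi {attrs : List (L × Option (Tm L))} {c : L} :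
      lookupAttr c attrs = none → (lookupAttr phi attrs).isSome →
      Step phi (dot (obj attrs) c) (dot (dot (obj attrs) phi) c)
  | appStep {attrs : List (L × Option (Tm L))} {c : L} {u : Tm L} :
      lookupAttr c attrs = some none →
      Step phi (app (obj attrs) c u) (obj (attachAttr c (incAt 0 u) attrs))

mutual
/-- Parallel reduction `⇛`. -/
inductive Par (phi : L) : Tm L → Tm L → Prop where
  | loc (n : Nat) : Par phi (Tm.loc n) (Tm.loc n)
  | obj {attrs attrs' : List (L × Option (Tm L))} :
      ParAttrs phi attrs attrs' → Par phi (Tm.obj attrs) (Tm.obj attrs')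
  | congDot {t t' : Tm L} (a : L) : Par phi t t' → Par phi (Tm.dot t a) (Tm.dot t' a)
  | congApp {t t' u u' : Tm L} (a : L) :
      Par phi t t' → Par phi u u' → Par phi (Tm.app t a u) (Tm.app t' a u')
  | dotPar {t : Tm L} {attrs : List (L × Option (Tm L))} {c : L} {tc : Tm L} :
      Par phi t (Tm.obj attrs) → lookupAttr c attrs = some (some tc) →
      Par phi (Tm.dot t c) (subst tc 0 (Tm.obj attrs))
  | dotPhi {t : Tm L} {attrs : List (L × Option (Tm L))} {c : L} :
      Par phi t (Tm.obj attrs) → lookupAttr c attrs = none →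
      (lookupAttr phi attrs).isSome →
      Par phi (Tm.dot t c) (Tm.dot (Tm.dot (Tm.obj attrs) phi) c)
  | appPar {t : Tm L} {attrs : List (L × Option (Tm L))} {c : L} {u u' : Tm L} :
      Par phi t (Tm.obj attrs) → lookupAttr c attrs = some none → Par phi u u' →
      Par phi (Tm.app t c u) (Tm.obj (attachAttr c (incAt 0 u') attrs))

/-- Pointwise parallel reduction on attribute lists: void attributes are kept,
attached attributes reduce in parallel. -/
inductive ParAttrs (phi : L) :
    List (L × Option (Tm L)) → List (L × Option (Tm L)) → Prop where
  | nil : ParAttrs phi [] []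
  | void {rest rest' : List (L × Option (Tm L))} (a : L) :
      ParAttrs phi rest rest' → ParAttrs phi ((a, none) :: rest) ((a, none) :: rest')
  | attached {t t' : Tm L} {rest rest' : List (L × Option (Tm L))} (a : L) :
      Par phi t t' → ParAttrs phi rest rest' →
      ParAttrs phi ((a, some t) :: rest) ((a, some t') :: rest')
end

/-- Head reduction `→h`. -/
inductive Head (phi : L) : Tm L → Tm L → Prop where
  | dotStep {attrs : List (L × Option (Tm L))} {c : L} {tc : Tm L} :
      lookupAttr c attrs = some (some tc) →
      Head phi (dot (obj attrs) c) (subst tc 0 (obj attrs))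
  | dotPhi {attrs : List (L × Option (Tm L))} {c : L} :
      lookupAttr c attrs = none → (lookupAttr phi attrs).isSome →
      Head phi (dot (obj attrs) c) (dot (dot (obj attrs) phi) c)
  | appStep {attrs : List (L × Option (Tm L))} {c : L} {u : Tm L} :
      lookupAttr c attrs = some none →
      Head phi (app (obj attrs) c u) (obj (attachAttr c (incAt 0 u) attrs))
  | congDot {t t' : Tm L} (a : L) : Head phi t t' → Head phi (dot t a) (dot t' a)
  | congApp {t t' u : Tm L} (a : L) : Head phi t t' → Head phi (app t a u) (app t' a u)

/-- Internal parallel reduction `⇛ᵢ`. -/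
inductive ParI (phi : L) : Tm L → Tm L → Prop where
  | loc (n : Nat) : ParI phi (Tm.loc n) (Tm.loc n)
  | obj {attrs attrs' : List (L × Option (Tm L))} :
      ParAttrs phi attrs attrs' → ParI phi (Tm.obj attrs) (Tm.obj attrs')
  | congDot {t t' : Tm L} (a : L) : ParI phi t t' → ParI phi (Tm.dot t a) (Tm.dot t' a)
  | congApp {t t' u u' : Tm L} (a : L) :
      ParI phi t t' → Par phi u u' → ParI phi (Tm.app t a u) (Tm.app t' a u')

/-- Internal (regular) reduction `→ᵢ`. -/
inductive StepI (phi : L) : Tm L → Tm L → Prop where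
  | congObj {t t' : Tm L} (pre post : List (L × Option (Tm L))) (b : L) :
      Step phi t t' →
      StepI phi (obj (pre ++ (b, some t) :: post)) (obj (pre ++ (b, some t') :: post))
  | congDot {t t' : Tm L} (a : L) : StepI phi t t' → StepI phi (dot t a) (dot t' a)
  | congAppL {t t' u : Tm L} (a : L) : StepI phi t t' → StepI phi (app t a u) (app t' a u)
  | congAppR {t u u' : Tm L} (a : L) : Step phi u u' → StepI phi (app t a u) (app t a u')

end Reductions

end Tm

end PhiCalc
namespace PhiCalc
namespace Tm
section Extra
variable {L : Type} [DecidableEq L]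

mutual
/-- Complete development `t⁺`. -/
def cd (phi : L) : Tm L → Tm L
  | loc n => loc n
  | dot t a =>
    match cd phi t with
    | obj attrs =>
      match lookupAttr a attrs with
      | some (some ta) => subst ta 0 (obj attrs)
      | some none => dot (obj attrs) a
      | none =>
        if (lookupAttr phi attrs).isSome then dot (dot (obj attrs) phi) a
        else dot (obj attrs) a
    | t' => dot t' a
  | app t a u =>
    match cd phi t with
    | obj attrs =>
      match lookupAttr a attrs with
      | some none => obj (attachAttr a (incAt 0 (cd phi u)) attrs)
      | _ => app (obj attrs) a (cd phi u)
    | t' => app t' a (cd phi u)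
  | obj attrs => obj (cdList phi attrs)

def cdList (phi : L) : List (L × Option (Tm L)) → List (L × Option (Tm L))
  | [] => []
  | (a, none) :: rest => (a, none) :: cdList phi rest
  | (a, some t) :: rest => (a, some (cd phi t)) :: cdList phi rest
end

/-- Head reduction as a (deterministic) partial function. -/
def headRed (phi : L) : Tm L → Option (Tm L)
  | loc _ => none
  | obj _ => none
  | dot t a =>
    match t with
    | obj attrs =>
      match lookupAttr a attrs with
      | some (some ta) => some (subst ta 0 (obj attrs))
      | some none => none
      | none =>
        if (lookupAttr phi attrs).isSome then some (dot (dot (obj attrs) phi) a)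
        else none
    | t => (headRed phi t).map (fun t' => dot t' a)
  | app t a u =>
    match t with
    | obj attrs =>
      match lookupAttr a attrs with
      | some none => some (obj (attachAttr a (incAt 0 u) attrs))
      | _ => none
    | t => (headRed phi t).map (fun t' => app t' a u)

mutual
/-- Normal order reduction `⇝ℓ` as a (deterministic) partial function:
head reduction first, otherwise reduce the leftmost subterm that reduces. -/
def nordRed (phi : L) : Tm L → Option (Tm L)
  | loc _ => none
  | dot t a =>
    match headRed phi (dot t a) with
    | some s => some s
    | none => (nordRed phi t).map (fun t' => dot t' a)
  | app t a u =>
    match headRed phi (app t a u) with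
    | some s => some s
    | none =>
      match nordRed phi t with
      | some t' => some (app t' a u)
      | none => (nordRed phi u).map (fun u' => app t a u')
  | obj attrs => (nordList phi attrs).map obj

def nordList (phi : L) : List (L × Option (Tm L)) → Option (List (L × Option (Tm L)))
  | [] => none
  | (a, none) :: rest => (nordList phi rest).map (fun rest' => (a, none) :: rest')
  | (a, some t) :: rest =>
    match nordRed phi t with
    | some t' => some ((a, some t') :: rest)
    | none => (nordList phi rest).map (fun rest' => (a, some t) :: rest')
end

/-- Normal order reduction relation. -/
def NOrd (phi : L) (t t' : Tm L) : Prop := nordRed phi t = some t'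

end Extra
end Tm
end PhiCalc

namespace PhiCalc
namespace Tm

section Commutation

variable {L : Type}

mutual
theorem incAt_incAt : ∀ (t : Tm L) {i j : ℕ}, i ≤ j →
    incAt i (incAt j t) = incAt (j + 1) (incAt i t)
  | loc m, i, j, h => by
    simp only [incAt]
    split_ifs <;> simp only [incAt] <;> split_ifs <;> first | rfl | omega
  | dot t a, i, j, h => by simp only [incAt, incAt_incAt t h]
  | app t a u, i, j, h => by simp only [incAt, incAt_incAt t h, incAt_incAt u h]
  | obj l, i, j, h => by simp only [incAt, incAtList_incAtList l (Nat.succ_le_succ h)]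

theorem incAtList_incAtList : ∀ (l : List (L × Option (Tm L))) {i j : ℕ}, i ≤ j →
    incAtList i (incAtList j l) = incAtList (j + 1) (incAtList i l)
  | [], i, j, h => by simp only [incAtList]
  | (a, none) :: l, i, j, h => by simp only [incAtList, incAtList_incAtList l h]
  | (a, some t) :: l, i, j, h => by
    simp only [incAtList, incAt_incAt t h, incAtList_incAtList l h]
end

mutual
theorem incAt_subst_of_le : ∀ (t u : Tm L) {i n : ℕ}, i ≤ n →
    incAt i (subst t n u) = subst (incAt i t) (n + 1) (incAt i u)
  | loc m, u, i, n, h => by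
    simp only [incAt, subst]
    split_ifs <;> simp only [incAt, subst] <;> split_ifs <;>
      first | rfl | omega | (congr 1; omega)
  | dot t a, u, i, n, h => by simp only [incAt, subst, incAt_subst_of_le t u h]
  | app t a v, u, i, n, h => by
    simp only [incAt, subst, incAt_subst_of_le t u h, incAt_subst_of_le v u h]
  | obj l, u, i, n, h => by
    simp only [incAt, subst, incAtList_substList_of_le l (incAt 0 u) (Nat.succ_le_succ h),
      incAt_incAt u (Nat.zero_le i)]

theorem incAtList_substList_of_le : ∀ (l : List (L × Option (Tm L))) (u : Tm L) {i n : ℕ},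
    i ≤ n → incAtList i (substList l n u) = substList (incAtList i l) (n + 1) (incAt i u)
  | [], u, i, n, h => by simp only [incAtList, substList]
  | (a, none) :: l, u, i, n, h => by
    simp only [incAtList, substList, incAtList_substList_of_le l u h]
  | (a, some t) :: l, u, i, n, h => by
    simp only [incAtList, substList, incAt_subst_of_le t u h, incAtList_substList_of_le l u h]
end

mutual
theorem incAt_subst_of_ge : ∀ (t u : Tm L) {i n : ℕ}, n ≤ i →
    incAt i (subst t n u) = subst (incAt (i + 1) t) n (incAt i u)
  | loc m, u, i, n, h => by
    simp only [incAt, subst]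
    split_ifs <;> simp only [incAt, subst] <;> split_ifs <;>
      first | rfl | omega | (congr 1; omega)
  | dot t a, u, i, n, h => by simp only [incAt, subst, incAt_subst_of_ge t u h]
  | app t a v, u, i, n, h => by
    simp only [incAt, subst, incAt_subst_of_ge t u h, incAt_subst_of_ge v u h]
  | obj l, u, i, n, h => by
    simp only [incAt, subst, incAtList_substList_of_ge l (incAt 0 u) (Nat.succ_le_succ h),
      incAt_incAt u (Nat.zero_le i)]

theorem incAtList_substList_of_ge : ∀ (l : List (L × Option (Tm L))) (u : Tm L) {i n : ℕ},
    n ≤ i → incAtList i (substList l n u) = substList (incAtList (i + 1) l) n (incAt i u)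
  | [], u, i, n, h => by simp only [incAtList, substList]
  | (a, none) :: l, u, i, n, h => by
    simp only [incAtList, substList, incAtList_substList_of_ge l u h]
  | (a, some t) :: l, u, i, n, h => by
    simp only [incAtList, substList, incAt_subst_of_ge t u h, incAtList_substList_of_ge l u h]
end

mutual
theorem subst_incAt_self : ∀ (t : Tm L) (n : ℕ) (u : Tm L), subst (incAt n t) n u = t
  | loc m, n, u => by
    simp only [incAt]
    split_ifs <;> simp only [subst] <;> split_ifs <;>
      first | rfl | omega
  | dot t a, n, u => by simp only [incAt, subst, subst_incAt_self t]
  | app t a v, n, u => by simp only [incAt, subst, subst_incAt_self t, subst_incAt_self v]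
  | obj l, n, u => by simp only [incAt, subst, substList_incAtList_self l]

theorem substList_incAtList_self : ∀ (l : List (L × Option (Tm L))) (n : ℕ) (u : Tm L),
    substList (incAtList n l) n u = l
  | [], n, u => by simp only [incAtList, substList]
  | (a, none) :: l, n, u => by simp only [incAtList, substList, substList_incAtList_self l]
  | (a, some t) :: l, n, u => by
    simp only [incAtList, substList, subst_incAt_self t, substList_incAtList_self l]
end

mutual
theorem subst_subst : ∀ (t u v : Tm L) {i n : ℕ}, i ≤ n →
    subst (subst t i u) n v = subst (subst t (n + 1) (incAt i v)) i (subst u n v)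
  | loc m, u, v, i, n, h => by
    simp only [subst]
    split_ifs <;> (try simp only [subst, subst_incAt_self]) <;> try split_ifs
    all_goals first | rfl | omega
  | dot t a, u, v, i, n, h => by simp only [subst, subst_subst t u v h]
  | app t a w, u, v, i, n, h => by
    simp only [subst, subst_subst t u v h, subst_subst w u v h]
  | obj l, u, v, i, n, h => by
    simp only [subst, substList_substList l (incAt 0 u) (incAt 0 v) (Nat.succ_le_succ h),
      incAt_incAt v (Nat.zero_le i), incAt_subst_of_le u v (Nat.zero_le n)]

theorem substList_substList : ∀ (l : List (L × Option (Tm L))) (u v : Tm L) {i n : ℕ},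
    i ≤ n → substList (substList l i u) n v =
      substList (substList l (n + 1) (incAt i v)) i (subst u n v)
  | [], u, v, i, n, h => by simp only [substList]
  | (a, none) :: l, u, v, i, n, h => by simp only [substList, substList_substList l u v h]
  | (a, some t) :: l, u, v, i, n, h => by
    simp only [substList, subst_subst t u v h, substList_substList l u v h]
end

variable [DecidableEq L]

theorem lookupAttr_incAtList (c : L) (n : ℕ) : ∀ l : List (L × Option (Tm L)),
    lookupAttr c (incAtList n l) = (lookupAttr c l).map (Option.map (incAt n))
  | [] => by simp only [incAtList, lookupAttr, Option.map_none]
  | (a, none) :: l => by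
    simp only [incAtList, lookupAttr, lookupAttr_incAtList c n l]
    split_ifs <;> rfl
  | (a, some t) :: l => by
    simp only [incAtList, lookupAttr, lookupAttr_incAtList c n l]
    split_ifs <;> rfl

theorem lookupAttr_substList (c : L) (n : ℕ) (u : Tm L) : ∀ l : List (L × Option (Tm L)),
    lookupAttr c (substList l n u) = (lookupAttr c l).map (Option.map (subst · n u))
  | [] => by simp only [substList, lookupAttr, Option.map_none]
  | (a, none) :: l => by
    simp only [substList, lookupAttr, lookupAttr_substList c n u l]
    split_ifs <;> rfl
  | (a, some t) :: l => by
    simp only [substList, lookupAttr, lookupAttr_substList c n u l]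
    split_ifs <;> rfl

theorem incAtList_attachAttr (c : L) (n : ℕ) (v : Tm L) : ∀ l : List (L × Option (Tm L)),
    incAtList n (attachAttr c v l) = attachAttr c (incAt n v) (incAtList n l)
  | [] => by simp only [incAtList, attachAttr]
  | (a, none) :: l => by
    simp only [incAtList, attachAttr]
    split_ifs <;> simp only [incAtList, incAtList_attachAttr c n v l]
  | (a, some t) :: l => by
    simp only [incAtList, attachAttr]
    split_ifs <;> simp only [incAtList, incAtList_attachAttr c n v l]

theorem substList_attachAttr (c : L) (n : ℕ) (u v : Tm L) : ∀ l : List (L × Option (Tm L)),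
    substList (attachAttr c v l) n u = attachAttr c (subst v n u) (substList l n u)
  | [] => by simp only [substList, attachAttr]
  | (a, none) :: l => by
    simp only [substList, attachAttr]
    split_ifs <;> simp only [substList, substList_attachAttr c n u v l]
  | (a, some t) :: l => by
    simp only [substList, attachAttr]
    split_ifs <;> simp only [substList, substList_attachAttr c n u v l]

end Commutation

section Congruence

variable {L : Type} [DecidableEq L] {phi : L}

mutual
theorem Par.incAt {t s : Tm L} : Par phi t s → ∀ n : ℕ, Par phi (t.incAt n) (s.incAt n)
  | .loc m, n => by
    simp only [Tm.incAt]
    split_ifs <;> exact .loc _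
  | .obj h, n => by
    simp only [Tm.incAt]
    exact .obj (h.incAtList (n + 1))
  | .congDot a h, n => by
    simp only [Tm.incAt]
    exact .congDot a (h.incAt n)
  | .congApp a h k, n => by
    simp only [Tm.incAt]
    exact .congApp a (h.incAt n) (k.incAt n)
  | .dotPar h hc, n => by
    have ih := h.incAt n
    rw [incAt_subst_of_ge _ _ (Nat.zero_le n)]
    simp only [Tm.incAt] at ih ⊢
    exact .dotPar ih (by rw [lookupAttr_incAtList, hc]; rfl)
  | .dotPhi h hc hp, n => by
    have ih := h.incAt n
    simp only [Tm.incAt] at ih ⊢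
    exact .dotPhi ih (by rw [lookupAttr_incAtList, hc]; rfl)
      (by rwa [lookupAttr_incAtList, Option.isSome_map])
  | .appPar h hc k, n => by
    have ih := h.incAt n
    simp only [Tm.incAt, incAtList_attachAttr, ← incAt_incAt _ (Nat.zero_le n)] at ih ⊢
    exact .appPar ih (by rw [lookupAttr_incAtList, hc]; rfl) (k.incAt n)

theorem ParAttrs.incAtList {l m : List (L × Option (Tm L))} :
    ParAttrs phi l m → ∀ n : ℕ, ParAttrs phi (Tm.incAtList n l) (Tm.incAtList n m)
  | .nil, n => by
    simp only [Tm.incAtList]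
    exact .nil
  | .void a h, n => by
    simp only [Tm.incAtList]
    exact .void a (h.incAtList n)
  | .attached a h k, n => by
    simp only [Tm.incAtList]
    exact .attached a (h.incAt n) (k.incAtList n)
end

mutual
theorem Par.subst {t s : Tm L} : Par phi t s → ∀ (n : ℕ) {q r : Tm L}, Par phi q r →
    Par phi (t.subst n q) (s.subst n r)
  | .loc m, n, q, r, hq => by
    simp only [Tm.subst]
    split_ifs
    exacts [.loc _, hq, .loc _]
  | .obj h, n, q, r, hq => by
    simp only [Tm.subst]
    exact .obj (h.substList (n + 1) (hq.incAt 0))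
  | .congDot a h, n, q, r, hq => by
    simp only [Tm.subst]
    exact .congDot a (h.subst n hq)
  | .congApp a h k, n, q, r, hq => by
    simp only [Tm.subst]
    exact .congApp a (h.subst n hq) (k.subst n hq)
  | .dotPar h hc, n, q, r, hq => by
    have ih := h.subst n hq
    rw [subst_subst _ _ _ (Nat.zero_le n)]
    simp only [Tm.subst] at ih ⊢
    exact .dotPar ih (by rw [lookupAttr_substList, hc]; rfl)
  | .dotPhi h hc hp, n, q, r, hq => by
    have ih := h.subst n hq
    simp only [Tm.subst] at ih ⊢
    exact .dotPhi ih (by rw [lookupAttr_substList, hc]; rfl)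
      (by rwa [lookupAttr_substList, Option.isSome_map])
  | .appPar h hc k, n, q, r, hq => by
    have ih := h.subst n hq
    simp only [Tm.subst, substList_attachAttr, ← incAt_subst_of_le _ _ (Nat.zero_le n)] at ih ⊢
    exact .appPar ih (by rw [lookupAttr_substList, hc]; rfl) (k.subst n hq)

theorem ParAttrs.substList {l m : List (L × Option (Tm L))} :
    ParAttrs phi l m → ∀ (n : ℕ) {q r : Tm L}, Par phi q r →
      ParAttrs phi (Tm.substList l n q) (Tm.substList m n r)
  | .nil, n, q, r, hq => by
    simp only [Tm.substList]
    exact .nil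
  | .void a h, n, q, r, hq => by
    simp only [Tm.substList]
    exact .void a (h.substList n hq)
  | .attached a h k, n, q, r, hq => by
    simp only [Tm.substList]
    exact .attached a (h.subst n hq) (k.substList n hq)
end

theorem ParI.par {t s : Tm L} (h : ParI phi t s) : Par phi t s := by
  induction h with
  | loc n => exact .loc n
  | obj h => exact .obj h
  | congDot a _ ih => exact .congDot a ih
  | congApp a _ hu ih => exact .congApp a ih hu

end Congruence

end Tm
end PhiCalc

open PhiCalc Tm in
/-- Substitution lemma for internal parallel reduction: if `t ⇛ᵢ s` and `q ⇛ᵢ r`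
then `t[ρ^n ↦ q] ⇛ᵢ s[ρ^n ↦ r]`. -/
theorem parI_subst {L : Type} [DecidableEq L] (phi : L) {t s q r : Tm L} (n : ℕ)
    (ht : ParI phi t s) (hq : ParI phi q r) :
    ParI phi (subst t n q) (subst s n r) := by
  induction ht with
  | loc m =>
    simp only [subst]
    split_ifs
    exacts [.loc _, hq, .loc _]
  | obj h =>
    simp only [subst]
    exact .obj (h.substList (n + 1) (hq.par.incAt 0))
  | congDot a _ ih =>
    simp only [subst]
    exact .congDot a ih
  | congApp a _ hu ih =>
    simp only [subst]
    exact .congApp a ih (hu.subst n hq.par)
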